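/- arXiv:2301.05283 — 2 statements merged into one kernel-verified Lean document; each statement's English description precedes it below -/
import Mathlib

section
/- Let H be the Hamiltonian of form (4) and K = S₃. Let y = (S,R) ∈ ℝ⁶ with R₁²+R₂² > 0, and set a = ⟨R,R⟩, g = ⟨S,R⟩, x = R₃, k = S₃, m = S₁R₂−S₂R₁. Then sgrad H(y) and sgrad K(y) are linearly dependent if and only if both of the following hold: (i) m = −(a−x²)·g₁(a,x), and (ii) (kx−g)(ka−gx)/(a−x²)² + x·g₁(a,x)² − (a−x²)·g₁(a,x)·∂₂g₁(a,x) + g·∂₂g₂(a,x) + k·∂₂g₃(a,x) + ∂₂V(a,x) = 0. -/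
noncomputable section

/-- ℝ⁶ with coordinates (S₁,S₂,S₃,R₁,R₂,R₃). -/
abbrev E6 := Fin 6 → ℝ

/-- Partial derivative of `f` at `y` in the `i`-th coordinate direction. -/
def pd (f : E6 → ℝ) (y : E6) (i : Fin 6) : ℝ := fderiv ℝ f y (Pi.single i 1)

/-- Cross product in ℝ³. -/
def cross (u v : Fin 3 → ℝ) : Fin 3 → ℝ :=
  ![u 1 * v 2 - u 2 * v 1, u 2 * v 0 - u 0 * v 2, u 0 * v 1 - u 1 * v 0]

/-- Euclidean inner product in ℝ³. -/
def dot (u v : Fin 3 → ℝ) : ℝ := u 0 * v 0 + u 1 * v 1 + u 2 * v 2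

/-- Assemble a point of ℝ⁶ from S- and R-blocks. -/
def pt (S R : Fin 3 → ℝ) : E6 := ![S 0, S 1, S 2, R 0, R 1, R 2]

/-- S-block of a point of ℝ⁶. -/
def Sv (y : E6) : Fin 3 → ℝ := ![y 0, y 1, y 2]

/-- R-block of a point of ℝ⁶. -/
def Rv (y : E6) : Fin 3 → ℝ := ![y 3, y 4, y 5]

/-- The Hamiltonian vector field (skew gradient)
`sgrad f = (∂f/∂S × S + ∂f/∂R × R, ∂f/∂S × R)`. -/
def sgrad (f : E6 → ℝ) (y : E6) : E6 :=
  pt (cross ![pd f y 0, pd f y 1, pd f y 2] (Sv y)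
        + cross ![pd f y 3, pd f y 4, pd f y 5] (Rv y))
     (cross ![pd f y 0, pd f y 1, pd f y 2] (Rv y))

/-- The Lie–Poisson bracket for e(3)*:
`{f,g}(S,R) = ⟨S, f_S × g_S⟩ + ⟨R, f_S × g_R⟩ + ⟨R, f_R × g_S⟩`. -/
def bracket (f g : E6 → ℝ) (y : E6) : ℝ :=
  dot (Sv y) (cross ![pd f y 0, pd f y 1, pd f y 2] ![pd g y 0, pd g y 1, pd g y 2])
  + dot (Rv y) (cross ![pd f y 0, pd f y 1, pd f y 2] ![pd g y 3, pd g y 4, pd g y 5])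
  + dot (Rv y) (cross ![pd f y 3, pd f y 4, pd f y 5] ![pd g y 0, pd g y 1, pd g y 2])

/-- The Hamiltonian of form (4). -/
def H4 (β : ℝ) (g₁ g₂ g₃ V : ℝ → ℝ → ℝ) (y : E6) : ℝ :=
  (1/2) * ((y 0)^2 + (y 1)^2 + (y 2)^2 / β)
  + g₁ ((y 3)^2 + (y 4)^2 + (y 5)^2) (y 5) * (y 0 * y 4 - y 1 * y 3)
  + g₂ ((y 3)^2 + (y 4)^2 + (y 5)^2) (y 5) * (y 0 * y 3 + y 1 * y 4 + y 2 * y 5)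
  + g₃ ((y 3)^2 + (y 4)^2 + (y 5)^2) (y 5) * y 2
  + V ((y 3)^2 + (y 4)^2 + (y 5)^2) (y 5)

/-- The reduced potential `W_{a,g}(k,x)`. -/
def W (β : ℝ) (g₁ g₂ g₃ V : ℝ → ℝ → ℝ) (a g k x : ℝ) : ℝ :=
  (g - k*x)^2 / (2*(a - x^2)) + k^2/(2*β) - (g₁ a x)^2 * (a - x^2)/2
  + g₂ a x * g + g₃ a x * k + V a x



theorem aux_fd (g : ℝ → ℝ → ℝ) (hg : ContDiff ℝ (⊤ : ℕ∞) (Function.uncurry g)) (y : E6) :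
    ∃ A : ℝ, HasFDerivAt (fun z : E6 => g ((z 3)^2 + (z 4)^2 + (z 5)^2) (z 5))
      (A • ((2 * y 3) • (ContinuousLinearMap.proj 3 : E6 →L[ℝ] ℝ)
          + (2 * y 4) • (ContinuousLinearMap.proj 4 : E6 →L[ℝ] ℝ)
          + (2 * y 5) • (ContinuousLinearMap.proj 5 : E6 →L[ℝ] ℝ))
        + (deriv (g ((y 3)^2 + (y 4)^2 + (y 5)^2)) (y 5)) •
          (ContinuousLinearMap.proj 5 : E6 →L[ℝ] ℝ)) y := by
  have hd : Differentiable ℝ (Function.uncurry g) := hg.differentiable (by simp)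
  set a := (y 3)^2 + (y 4)^2 + (y 5)^2 with ha
  have hG := (hd (a, y 5)).hasFDerivAt
  have hp : ∀ i : Fin 6, HasFDerivAt (fun z : E6 => z i)
      (ContinuousLinearMap.proj i : E6 →L[ℝ] ℝ) y := fun i => hasFDerivAt_apply i y
  have hB : deriv (g a) (y 5) = fderiv ℝ (Function.uncurry g) (a, y 5) (0, 1) := by
    have h1 : HasDerivAt (fun t : ℝ => (a, t)) ((0 : ℝ), (1 : ℝ)) (y 5) :=
      (hasDerivAt_const _ _).prodMk (hasDerivAt_id _)
    exact (HasFDerivAt.comp_hasDerivAt (y 5) hG h1).deriv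
  refine ⟨fderiv ℝ (Function.uncurry g) (a, y 5) (1, 0), ?_⟩
  have hin : HasFDerivAt (fun z : E6 => ((z 3)^2 + (z 4)^2 + (z 5)^2, z 5)) _ y :=
    ((((hp 3).pow 2).add ((hp 4).pow 2)).add ((hp 5).pow 2)).prodMk (hp 5)
  have hc := HasFDerivAt.comp y hG hin
  refine hc.congr_fderiv ?_
  ext v
  rw [hB]
  have key : ∀ p q : ℝ, fderiv ℝ (Function.uncurry g) (a, y 5) (p, q)
      = p * fderiv ℝ (Function.uncurry g) (a, y 5) (1, 0)
        + q * fderiv ℝ (Function.uncurry g) (a, y 5) (0, 1) := by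
    intro p q
    have : (p, q) = p • ((1 : ℝ), (0 : ℝ)) + q • ((0 : ℝ), (1 : ℝ)) := by simp
    rw [this, map_add, map_smul, map_smul]; simp
  simp only [ContinuousLinearMap.comp_apply, ContinuousLinearMap.prod_apply]
  rw [key]
  simp
  ring

theorem aux_pd (β : ℝ) (g₁ g₂ g₃ V : ℝ → ℝ → ℝ)
    (hg₁ : ContDiff ℝ (⊤ : ℕ∞) (Function.uncurry g₁))
    (hg₂ : ContDiff ℝ (⊤ : ℕ∞) (Function.uncurry g₂))
    (hg₃ : ContDiff ℝ (⊤ : ℕ∞) (Function.uncurry g₃))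
    (hV : ContDiff ℝ (⊤ : ℕ∞) (Function.uncurry V))
    (y : E6) (a B : ℝ) (ha : a = (y 3)^2 + (y 4)^2 + (y 5)^2)
    (hB : B = (y 0 * y 4 - y 1 * y 3) * deriv (g₁ a) (y 5)
      + (y 0 * y 3 + y 1 * y 4 + y 2 * y 5) * deriv (g₂ a) (y 5)
      + y 2 * deriv (g₃ a) (y 5) + deriv (V a) (y 5)) :
    ∃ A : ℝ,
      pd (H4 β g₁ g₂ g₃ V) y 0 = y 0 + g₁ a (y 5) * y 4 + g₂ a (y 5) * y 3 ∧
      pd (H4 β g₁ g₂ g₃ V) y 1 = y 1 - g₁ a (y 5) * y 3 + g₂ a (y 5) * y 4 ∧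
      pd (H4 β g₁ g₂ g₃ V) y 2 = y 2 / β + g₂ a (y 5) * y 5 + g₃ a (y 5) ∧
      pd (H4 β g₁ g₂ g₃ V) y 3 = A * y 3 - g₁ a (y 5) * y 1 + g₂ a (y 5) * y 0 ∧
      pd (H4 β g₁ g₂ g₃ V) y 4 = A * y 4 + g₁ a (y 5) * y 0 + g₂ a (y 5) * y 1 ∧
      pd (H4 β g₁ g₂ g₃ V) y 5 = A * y 5 + g₂ a (y 5) * y 2 + B := by
  obtain ⟨A1, h1⟩ := aux_fd g₁ hg₁ y
  obtain ⟨A2, h2⟩ := aux_fd g₂ hg₂ y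
  obtain ⟨A3, h3⟩ := aux_fd g₃ hg₃ y
  obtain ⟨A4, h4⟩ := aux_fd V hV y
  rw [← ha] at h1 h2 h3 h4
  have hp : ∀ i : Fin 6, HasFDerivAt (fun z : E6 => z i)
      (ContinuousLinearMap.proj i : E6 →L[ℝ] ℝ) y := fun i => hasFDerivAt_apply i y
  have hm := ((hp 0).mul (hp 4)).sub ((hp 1).mul (hp 3))
  have hgg := (((hp 0).mul (hp 3)).add ((hp 1).mul (hp 4))).add ((hp 2).mul (hp 5))
  have hq := ((((hp 0).pow 2).add ((hp 1).pow 2)).add (((hp 2).pow 2).mul_const β⁻¹)).const_mul (1/2)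
  have hH := (((hq.add (h1.mul hm)).add (h2.mul hgg)).add (h3.mul (hp 2))).add h4
  have hH' : HasFDerivAt (H4 β g₁ g₂ g₃ V) _ y := hH
  refine ⟨2 * (A1 * (y 0 * y 4 - y 1 * y 3) + A2 * (y 0 * y 3 + y 1 * y 4 + y 2 * y 5)
    + A3 * y 2 + A4), ?_⟩
  unfold pd
  rw [hH'.fderiv]
  subst hB
  refine ⟨?_, ?_, ?_, ?_, ?_, ?_⟩ <;> simp [Pi.single_apply, ← ha] <;> ring

theorem aux_K (y : E6) : sgrad (fun z => z 2) y = ![-y 1, y 0, 0, -y 4, y 3, 0] := by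
  have h : ∀ i, pd (fun z => z 2) y i = if i = 2 then 1 else 0 := by
    intro i
    unfold pd
    rw [(hasFDerivAt_apply (𝕜 := ℝ) (2 : Fin 6) y).fderiv]
    simp [Pi.single_apply, eq_comm]
  unfold sgrad
  simp only [h]
  ext i
  fin_cases i <;> simp [pt, cross, Sv, Rv]

theorem aux_dep (u v : E6) (hv : v ≠ 0) :
    (¬ LinearIndependent ℝ ![u, v]) ↔ ∃ c : ℝ, u = c • v := by
  rw [LinearIndependent.pair_symm_iff, LinearIndependent.pair_iff' hv]
  push Not
  exact ⟨fun ⟨c, h⟩ => ⟨c, h.symm⟩, fun ⟨c, h⟩ => ⟨c, h.symm⟩⟩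

theorem aux_alg (S1 S2 k R1 R2 x G1 G2 q A d1 d2 d3 d4 : ℝ) (hD : 0 < R1^2 + R2^2) :
    (∃ c : ℝ,
      (S2 - G1 * R1 + G2 * R2) * k - q * S2
        + ((A * R2 + G1 * S1 + G2 * S2) * x - (A * x + G2 * k
          + ((S1 * R2 - S2 * R1) * d1 + (S1 * R1 + S2 * R2 + k * x) * d2 + k * d3 + d4)) * R2)
        = -(c * S2) ∧
      q * S1 - (S1 + G1 * R2 + G2 * R1) * k
        + ((A * x + G2 * k
          + ((S1 * R2 - S2 * R1) * d1 + (S1 * R1 + S2 * R2 + k * x) * d2 + k * d3 + d4)) * R1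
          - (A * R1 - G1 * S2 + G2 * S1) * x)
        = c * S1 ∧
      (S1 + G1 * R2 + G2 * R1) * S2 - (S2 - G1 * R1 + G2 * R2) * S1
        + ((A * R1 - G1 * S2 + G2 * S1) * R2 - (A * R2 + G1 * S1 + G2 * S2) * R1) = 0 ∧
      (S2 - G1 * R1 + G2 * R2) * x - q * R2 = -(c * R2) ∧
      q * R1 - (S1 + G1 * R2 + G2 * R1) * x = c * R1 ∧
      (S1 + G1 * R2 + G2 * R1) * R2 - (S2 - G1 * R1 + G2 * R2) * R1 = 0) ↔
    (S1 * R2 - S2 * R1 = -((R1^2 + R2^2 + x^2 - x^2) * G1) ∧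
      (k * x - (S1 * R1 + S2 * R2 + k * x)) *
        (k * (R1^2 + R2^2 + x^2) - (S1 * R1 + S2 * R2 + k * x) * x)
          / (R1^2 + R2^2 + x^2 - x^2)^2 + x * G1^2
        - (R1^2 + R2^2 + x^2 - x^2) * G1 * d1
        + (S1 * R1 + S2 * R2 + k * x) * d2 + k * d3 + d4 = 0) := by
  have hD0 : R1^2 + R2^2 ≠ 0 := hD.ne'
  rw [show R1^2 + R2^2 + x^2 - x^2 = R1^2 + R2^2 by ring]
  by_cases hm : S1 * R2 - S2 * R1 = -((R1^2 + R2^2) * G1)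
  swap
  · constructor
    · rintro ⟨c, -, -, -, -, -, h⟩
      exact absurd (by linear_combination h) hm
    · rintro ⟨h, -⟩
      exact absurd h hm
  obtain ⟨s, hs⟩ : ∃ s, s = (S1 * R1 + S2 * R2) / (R1^2 + R2^2) := ⟨_, rfl⟩
  rw [eq_div_iff hD0] at hs
  have e1 : S1 = s * R1 - G1 * R2 := by
    apply mul_right_cancel₀ hD0
    linear_combination R2 * hm - R1 * hs
  have e2 : S2 = s * R2 + G1 * R1 := by
    apply mul_right_cancel₀ hD0
    linear_combination -R1 * hm - R2 * hs
  subst e1 e2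
  clear hs hm
  have hfrac : (k * x - ((s * R1 - G1 * R2) * R1 + (s * R2 + G1 * R1) * R2 + k * x)) *
        (k * (R1^2 + R2^2 + x^2) - ((s * R1 - G1 * R2) * R1 + (s * R2 + G1 * R1) * R2 + k * x) * x)
          / (R1^2 + R2^2)^2 = -s * (k - s * x) := by
    rw [div_eq_iff (pow_ne_zero 2 hD0)]
    ring
  rw [hfrac]
  constructor
  · rintro ⟨c, h0, h1, -, h3, h4, -⟩
    refine ⟨by ring, ?_⟩
    have hc : c = q - (s + G2) * x := by
      apply mul_right_cancel₀ hD0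
      linear_combination R2 * h3 - R1 * h4
    subst hc
    apply mul_right_cancel₀ hD0
    linear_combination -R2 * h0 + R1 * h1
  · rintro ⟨-, h⟩
    refine ⟨q - (s + G2) * x, ?_, ?_, ?_, ?_, ?_, ?_⟩
    · linear_combination -R2 * h
    · linear_combination R1 * h
    all_goals ring

/-- characterization of points of rank ≤ 1 with R₁²+R₂² > 0. -/
theorem statement9 (β : ℝ) (hβ : 0 < β) (g₁ g₂ g₃ V : ℝ → ℝ → ℝ)
    (hg₁ : ContDiff ℝ (⊤ : ℕ∞) (Function.uncurry g₁))
    (hg₂ : ContDiff ℝ (⊤ : ℕ∞) (Function.uncurry g₂))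
    (hg₃ : ContDiff ℝ (⊤ : ℕ∞) (Function.uncurry g₃))
    (hV : ContDiff ℝ (⊤ : ℕ∞) (Function.uncurry V))
    (y : E6) (hy : (y 3)^2 + (y 4)^2 > 0) :
    let H : E6 → ℝ := H4 β g₁ g₂ g₃ V
    let K : E6 → ℝ := fun z => z 2
    let a : ℝ := (y 3)^2 + (y 4)^2 + (y 5)^2
    let g : ℝ := y 0 * y 3 + y 1 * y 4 + y 2 * y 5
    let x : ℝ := y 5
    let k : ℝ := y 2
    let m : ℝ := y 0 * y 4 - y 1 * y 3
    (¬ LinearIndependent ℝ ![sgrad H y, sgrad K y]) ↔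
      (m = -((a - x^2) * g₁ a x) ∧
       (k*x - g)*(k*a - g*x)/(a - x^2)^2 + x * (g₁ a x)^2
         - (a - x^2) * g₁ a x * deriv (g₁ a) x
         + g * deriv (g₂ a) x + k * deriv (g₃ a) x + deriv (V a) x = 0) := by
  intro H K a g x k m
  obtain ⟨A, p0, p1, p2, p3, p4, p5⟩ := aux_pd β g₁ g₂ g₃ V hg₁ hg₂ hg₃ hV y a _ rfl rfl
  have hv : sgrad K y ≠ 0 := by
    intro h
    have hK : sgrad K y = _ := aux_K y
    rw [hK] at h
    have e3 := congrFun h 3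
    have e4 := congrFun h 4
    simp at e3 e4
    simp [e3, e4] at hy
  rw [aux_dep _ _ hv]
  have hK : sgrad K y = _ := aux_K y
  rw [hK]
  have hex : ∀ c : ℝ, sgrad H y = c • ![-y 1, y 0, 0, -y 4, y 3, 0] ↔
      ∀ i, sgrad H y i = (c • ![-y 1, y 0, 0, -y 4, y 3, 0] : E6) i := fun c => funext_iff
  simp only [hex, Fin.forall_fin_succ]
  simp [sgrad, pt, cross, Sv, Rv, H, p0, p1, p2, p3, p4, p5]
  exact aux_alg (y 0) (y 1) (y 2) (y 3) (y 4) (y 5) (g₁ a (y 5)) (g₂ a (y 5)) _ A _ _ _ _ hy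

end
end

section
/- Let H be the Hamiltonian of form (4), K = S₃, and fix a > 0, g ∈ ℝ. Then the set of points y in M⁴_{a,g} with R₁²+R₂² > 0 at which sgrad H(y) and sgrad K(y) are linearly dependent is exactly the union, over all pairs (k,x) with x² < a satisfying (kx−g)(ka−gx)/(a−x²)² + x·g₁(a,x)² − (a−x²)·g₁(a,x)·∂₂g₁(a,x) + g·∂₂g₂(a,x) + k·∂₂g₃(a,x) + ∂₂V(a,x) = 0, of the circles { ( ((g−kx)cos φ − (a−x²)g₁(a,x)sin φ)/√(a−x²), ((g−kx)sin φ + (a−x²)g₁(a,x)cos φ)/√(a−x²), k, √(a−x²)cos φ, √(a−x²)sin φ, x ) : φ ∈ ℝ }. -/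
noncomputable section

open ContinuousLinearMap in
lemma hasF (G : ℝ → ℝ → ℝ) (hG : ContDiff ℝ (⊤ : ℕ∞) (Function.uncurry G)) (y : E6) (a : ℝ)
    (ha : (y 3)^2 + (y 4)^2 + (y 5)^2 = a) :
    ∃ P : ℝ, HasFDerivAt (fun z : E6 => G ((z 3)^2 + (z 4)^2 + (z 5)^2) (z 5))
      ((P * (2 * y 3)) • (proj 3 : E6 →L[ℝ] ℝ) + (P * (2 * y 4)) • (proj 4 : E6 →L[ℝ] ℝ)
        + (P * (2 * y 5) + deriv (G a) (y 5)) • (proj 5 : E6 →L[ℝ] ℝ)) y := by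
  have hd : HasFDerivAt (Function.uncurry G) (fderiv ℝ (Function.uncurry G) (a, y 5)) (a, y 5) :=
    ((hG.differentiable (by simp)) _).hasFDerivAt
  set L := fderiv ℝ (Function.uncurry G) (a, y 5)
  have hQ : deriv (G a) (y 5) = L (0, 1) := by
    have h1 : HasDerivAt (fun t : ℝ => (a, t)) ((0 : ℝ), (1 : ℝ)) (y 5) :=
      (hasDerivAt_const _ _).prodMk (hasDerivAt_id _)
    exact (hd.comp_hasDerivAt (y 5) h1).deriv
  have hp : ∀ i : Fin 6, HasFDerivAt (fun z : E6 => z i) (proj i : E6 →L[ℝ] ℝ) y :=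
    fun i => (proj i : E6 →L[ℝ] ℝ).hasFDerivAt
  refine ⟨L (1, 0), ?_⟩
  have hin := ((((hp 3).pow 2).add ((hp 4).pow 2)).add ((hp 5).pow 2)).prodMk (hp 5)
  subst ha
  have hc := HasFDerivAt.comp y hd hin
  refine hc.congr_fderiv ?_
  ext v
  have hlin : ∀ p q : ℝ, L (p, q) = p * L (1, 0) + q * L (0, 1) := by
    intro p q
    have : ((p, q) : ℝ × ℝ) = p • ((1 : ℝ), (0 : ℝ)) + q • ((0 : ℝ), (1 : ℝ)) := by simp
    rw [this, map_add, map_smul, map_smul]; simp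
  rw [hQ]
  simp
  rw [hlin]
  ring

open ContinuousLinearMap in
lemma pdH (β : ℝ) (g₁ g₂ g₃ V : ℝ → ℝ → ℝ)
    (hg₁ : ContDiff ℝ (⊤ : ℕ∞) (Function.uncurry g₁))
    (hg₂ : ContDiff ℝ (⊤ : ℕ∞) (Function.uncurry g₂))
    (hg₃ : ContDiff ℝ (⊤ : ℕ∞) (Function.uncurry g₃))
    (hV : ContDiff ℝ (⊤ : ℕ∞) (Function.uncurry V)) (y : E6) (a : ℝ)
    (ha : (y 3)^2 + (y 4)^2 + (y 5)^2 = a) :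
    ∃ T : ℝ,
      pd (H4 β g₁ g₂ g₃ V) y 0 = y 0 + g₁ a (y 5) * y 4 + g₂ a (y 5) * y 3 ∧
      pd (H4 β g₁ g₂ g₃ V) y 1 = y 1 - g₁ a (y 5) * y 3 + g₂ a (y 5) * y 4 ∧
      pd (H4 β g₁ g₂ g₃ V) y 2 = y 2 / β + g₂ a (y 5) * y 5 + g₃ a (y 5) ∧
      pd (H4 β g₁ g₂ g₃ V) y 3 = - g₁ a (y 5) * y 1 + g₂ a (y 5) * y 0 + T * y 3 ∧
      pd (H4 β g₁ g₂ g₃ V) y 4 = g₁ a (y 5) * y 0 + g₂ a (y 5) * y 1 + T * y 4 ∧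
      pd (H4 β g₁ g₂ g₃ V) y 5 = g₂ a (y 5) * y 2 + T * y 5 +
        (deriv (g₁ a) (y 5) * (y 0 * y 4 - y 1 * y 3)
         + deriv (g₂ a) (y 5) * (y 0 * y 3 + y 1 * y 4 + y 2 * y 5)
         + deriv (g₃ a) (y 5) * y 2 + deriv (V a) (y 5)) := by
  obtain ⟨P1, h1⟩ := hasF g₁ hg₁ y a ha
  obtain ⟨P2, h2⟩ := hasF g₂ hg₂ y a ha
  obtain ⟨P3, h3⟩ := hasF g₃ hg₃ y a ha
  obtain ⟨P4, h4⟩ := hasF V hV y a ha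
  have hp : ∀ i : Fin 6, HasFDerivAt (fun z : E6 => z i) (proj i : E6 →L[ℝ] ℝ) y :=
    fun i => (proj i : E6 →L[ℝ] ℝ).hasFDerivAt
  have hH := (((((((hp 0).pow 2).add ((hp 1).pow 2)).add (((hp 2).pow 2).mul_const β⁻¹)).const_mul
      (1/2 : ℝ)).add (h1.mul (((hp 0).mul (hp 4)).sub ((hp 1).mul (hp 3))))).add
      (h2.mul ((((hp 0).mul (hp 3)).add ((hp 1).mul (hp 4))).add ((hp 2).mul (hp 5))))).add
      (h3.mul (hp 2)) |>.add h4
  have hf : fderiv ℝ (H4 β g₁ g₂ g₃ V) y = _ := hH.fderiv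
  refine ⟨2 * (P1 * (y 0 * y 4 - y 1 * y 3) + P2 * (y 0 * y 3 + y 1 * y 4 + y 2 * y 5)
    + P3 * y 2 + P4), ?_⟩
  refine ⟨?_, ?_, ?_, ?_, ?_, ?_⟩ <;>
  · simp only [pd]
    rw [hf]
    simp [Pi.single_apply, ha]
    try ring

lemma pdK (y : E6) (i : Fin 6) : pd (fun z => z 2) y i = if i = 2 then 1 else 0 := by
  have : HasFDerivAt (fun z : E6 => z 2) (ContinuousLinearMap.proj 2 : E6 →L[ℝ] ℝ) y :=
    (ContinuousLinearMap.proj 2 : E6 →L[ℝ] ℝ).hasFDerivAt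
  simp [pd, this.fderiv, Pi.single_apply, eq_comm]

lemma core (β : ℝ) (g₁ g₂ g₃ V : ℝ → ℝ → ℝ)
    (hg₁ : ContDiff ℝ (⊤ : ℕ∞) (Function.uncurry g₁))
    (hg₂ : ContDiff ℝ (⊤ : ℕ∞) (Function.uncurry g₂))
    (hg₃ : ContDiff ℝ (⊤ : ℕ∞) (Function.uncurry g₃))
    (hV : ContDiff ℝ (⊤ : ℕ∞) (Function.uncurry V)) (y : E6) (a g : ℝ)
    (ha : (y 3)^2 + (y 4)^2 + (y 5)^2 = a)
    (hg : y 0 * y 3 + y 1 * y 4 + y 2 * y 5 = g)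
    (hpos : (y 3)^2 + (y 4)^2 > 0) (ν : ℝ) (hν : ν * (a - y 5 ^ 2) = g - y 2 * y 5) :
    ¬ LinearIndependent ℝ ![sgrad (H4 β g₁ g₂ g₃ V) y, sgrad (fun z => z 2) y] ↔
    (y 0 = ν * y 3 - g₁ a (y 5) * y 4 ∧ y 1 = ν * y 4 + g₁ a (y 5) * y 3 ∧
      ν * (ν * y 5 - y 2) + y 5 * (g₁ a (y 5))^2
          - (a - (y 5)^2) * g₁ a (y 5) * deriv (g₁ a) (y 5)
          + g * deriv (g₂ a) (y 5) + y 2 * deriv (g₃ a) (y 5) + deriv (V a) (y 5) = 0) := by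
  obtain ⟨T, h0, h1, h2, h3, h4, h5⟩ := pdH β g₁ g₂ g₃ V hg₁ hg₂ hg₃ hV y a ha
  have hK : sgrad (fun z => z 2) y = ![- y 1, y 0, 0, - y 4, y 3, 0] := by
    simp [sgrad, pdK, pt, cross, Sv, Rv]
  have hKne : sgrad (fun z => z 2) y ≠ 0 := by
    rw [hK]
    intro h
    have e3 := congrFun h 3
    have e4 := congrFun h 4
    simp at e3 e4
    simp [e3, e4] at hpos
  rw [linearIndependent_fin2]
  simp only [Matrix.cons_val_one, Matrix.cons_val_zero, ne_eq, hKne, not_false_eq_true, true_and,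
    not_forall, not_not]
  rw [hK]
  simp only [sgrad, h0, h1, h2, h3, h4, h5, hg]
  generalize g₁ a (y 5) = G1
  generalize g₂ a (y 5) = G2
  generalize g₃ a (y 5) = G3
  generalize deriv (g₁ a) (y 5) = D1
  generalize deriv (g₂ a) (y 5) = D2
  generalize deriv (g₃ a) (y 5) = D3
  generalize deriv (V a) (y 5) = D4
  simp only [funext_iff, Fin.forall_fin_succ, pt, cross, Sv, Rv]
  simp
  generalize y 0 = s1 at *
  generalize y 1 = s2 at *
  generalize y 2 = k at *
  generalize y 3 = r1 at *
  generalize y 4 = r2 at *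
  generalize y 5 = x at *
  have hr : r1^2 + r2^2 ≠ 0 := ne_of_gt hpos
  have hax : a - x^2 = r1^2+r2^2 := by linarith
  rw [hax] at hν ⊢
  generalize k / β = kb
  constructor
  · rintro ⟨l, e1, e2, e3, e4, e5, e6⟩
    have hs1 : s1 = ν * r1 - G1 * r2 := by
      apply mul_left_cancel₀ hr
      linear_combination (-r1) * hν + r1 * hg - r2 * e6
    have hs2 : s2 = ν * r2 + G1 * r1 := by
      apply mul_left_cancel₀ hr
      linear_combination (-r2) * hν + r2 * hg + r1 * e6
    refine ⟨hs1, hs2, ?_⟩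
    clear hK hKne h0 h1 h2 h3 h4 h5
    subst hs1 hs2
    have hl : l = kb + G2 * x + G3 - (ν + G2) * x := by
      apply mul_left_cancel₀ hr
      linear_combination r1 * e5 - r2 * e4
    subst hl
    apply mul_left_cancel₀ hr
    linear_combination r2 * e1 - r1 * e2
  · rintro ⟨hs1, hs2, hc⟩
    clear hK hKne h0 h1 h2 h3 h4 h5
    subst hs1 hs2
    refine ⟨kb + G2 * x + G3 - (ν + G2) * x, ?_, ?_, ?_, ?_, ?_, ?_⟩
    · linear_combination r2 * hc
    · linear_combination (-r1) * hc
    all_goals ring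

/-- the set of rank-1 singular points on M⁴_{a,g} is a union of circles. -/
theorem statement10 (β : ℝ) (hβ : 0 < β) (g₁ g₂ g₃ V : ℝ → ℝ → ℝ)
    (hg₁ : ContDiff ℝ (⊤ : ℕ∞) (Function.uncurry g₁))
    (hg₂ : ContDiff ℝ (⊤ : ℕ∞) (Function.uncurry g₂))
    (hg₃ : ContDiff ℝ (⊤ : ℕ∞) (Function.uncurry g₃))
    (hV : ContDiff ℝ (⊤ : ℕ∞) (Function.uncurry V))
    (a g : ℝ) (ha : 0 < a) :
    let H : E6 → ℝ := H4 β g₁ g₂ g₃ V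
    let K : E6 → ℝ := fun z => z 2
    {y : E6 | ((y 3)^2 + (y 4)^2 + (y 5)^2 = a ∧
        y 0 * y 3 + y 1 * y 4 + y 2 * y 5 = g) ∧
        (y 3)^2 + (y 4)^2 > 0 ∧
        ¬ LinearIndependent ℝ ![sgrad H y, sgrad K y]}
    = {y : E6 | ∃ k x φ : ℝ, x^2 < a ∧
        ((k*x - g)*(k*a - g*x)/(a - x^2)^2 + x * (g₁ a x)^2
          - (a - x^2) * g₁ a x * deriv (g₁ a) x
          + g * deriv (g₂ a) x + k * deriv (g₃ a) x + deriv (V a) x = 0) ∧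
        y = ![((g - k*x) * Real.cos φ - (a - x^2) * g₁ a x * Real.sin φ) / Real.sqrt (a - x^2),
              ((g - k*x) * Real.sin φ + (a - x^2) * g₁ a x * Real.cos φ) / Real.sqrt (a - x^2),
              k,
              Real.sqrt (a - x^2) * Real.cos φ,
              Real.sqrt (a - x^2) * Real.sin φ,
              x]} := by
  intro H K
  ext y
  simp only [Set.mem_setOf_eq]
  constructor
  · rintro ⟨⟨ha', hg'⟩, hpos, hli⟩
    have hD : 0 < a - y 5 ^ 2 := by linarith
    have hD0 := hD.ne'
    have hc := (core β g₁ g₂ g₃ V hg₁ hg₂ hg₃ hV y a g ha' hg' hpos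
      ((g - y 2 * y 5) / (a - y 5 ^ 2)) (by field_simp)).1 hli
    obtain ⟨h0, h1, h2⟩ := hc
    have hs := Real.sqrt_pos.2 hD
    have hsq := Real.sq_sqrt hD.le
    have hn : ‖(⟨y 3, y 4⟩ : ℂ)‖ = Real.sqrt (a - y 5 ^ 2) := by
      rw [Complex.norm_def, Complex.normSq_mk]
      congr 1
      linarith
    have hc3 := Complex.norm_mul_cos_arg ⟨y 3, y 4⟩
    have hc4 := Complex.norm_mul_sin_arg ⟨y 3, y 4⟩
    rw [hn] at hc3 hc4
    simp only at hc3 hc4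
    refine ⟨y 2, y 5, Complex.arg ⟨y 3, y 4⟩, by linarith, ?_, ?_⟩
    · rw [← h2]
      congr 5
      field_simp
      ring
    · generalize Complex.arg ⟨y 3, y 4⟩ = φ at *
      generalize Real.sqrt (a - y 5 ^ 2) = s at *
      have hs0 := hs.ne'
      funext i
      fin_cases i
      · simp
        rw [h0, ← hc3, ← hc4, ← hsq]
        field_simp
      · simp
        rw [h1, ← hc3, ← hc4, ← hsq]
        field_simp
      all_goals simp [hc3, hc4]
  · rintro ⟨k, x, φ, hx, hc, hy⟩
    have hD : 0 < a - x ^ 2 := by linarith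
    have hD0 := hD.ne'
    have hs := Real.sqrt_pos.2 hD
    have hsq := Real.sq_sqrt hD.le
    generalize Real.sqrt (a - x ^ 2) = s at *
    have hs0 := hs.ne'
    have hcs := Real.sin_sq_add_cos_sq φ
    generalize Real.sin φ = sn at *
    generalize Real.cos φ = c at *
    have y0 : y 0 = ((g - k * x) / (a - x ^ 2)) * (s * c) - g₁ a x * (s * sn) := by
      rw [hy, ← hsq]; simp; field_simp
    have y1 : y 1 = ((g - k * x) / (a - x ^ 2)) * (s * sn) + g₁ a x * (s * c) := by
      rw [hy, ← hsq]; simp; field_simp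
    have y2 : y 2 = k := by rw [hy]; simp
    have y3 : y 3 = s * c := by rw [hy]; simp
    have y4 : y 4 = s * sn := by rw [hy]; simp
    have y5 : y 5 = x := by rw [hy]; simp
    clear hy
    have hrr : (y 3)^2 + (y 4)^2 = a - x^2 := by
      rw [y3, y4]; linear_combination s^2 * hcs + hsq
    have ha' : (y 3)^2 + (y 4)^2 + (y 5)^2 = a := by rw [hrr, y5]; ring
    have hν : (g - k * x) / (a - x ^ 2) * (a - x ^ 2) = g - k * x := by field_simp
    have hg' : y 0 * y 3 + y 1 * y 4 + y 2 * y 5 = g := by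
      rw [y0, y1, ← y3, ← y4, y2, y5]
      linear_combination (g - k * x) / (a - x ^ 2) * hrr + hν
    have hpos : (y 3)^2 + (y 4)^2 > 0 := by rw [hrr]; exact hD
    refine ⟨⟨ha', hg'⟩, hpos, ?_⟩
    refine (core β g₁ g₂ g₃ V hg₁ hg₂ hg₃ hV y a g ha' hg' hpos
      ((g - k * x) / (a - x ^ 2)) (by rw [y2, y5, hν])).2 ⟨?_, ?_, ?_⟩
    · rw [y5, y3, y4, y0]
    · rw [y5, y3, y4, y1]
    · rw [y5, y2, ← hc]
      congr 5
      field_simp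
      ring

end
end
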